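/- Let ρ, e_ρ : ℝ³ → ℝ be smooth with ρ(x) > 0 for all x, let e_v : ℝ³ → ℝ³ be smooth and compactly supported, set v := e_v/ρ, let μ ≥ 0, κ ≥ 0 be constants and μ̂ := (4/3)μ + κ. Then ∫_{ℝ³} [ e_ρ (−div e_v) + e_v · ( −grad e_ρ − (1/ρ)((curl v) × e_v) − (1/ρ) curl( μ curl v ) + (1/ρ) grad( μ̂ div v ) ) ] dx = − ∫_{ℝ³} [ μ ‖curl v‖² + μ̂ (div v)² ] dx ≤ 0. -/

import Mathlib

open MeasureTheory Matrix

noncomputable section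

/-- Points of ℝ³. -/
abbrev R3 : Type := Fin 3 → ℝ

/-- Partial derivative `∂f/∂xᵢ` of a scalar field. -/
def pd (i : Fin 3) (f : R3 → ℝ) (x : R3) : ℝ := fderiv ℝ f x (Pi.single i 1)

/-- Gradient of a scalar field. -/
def grad (f : R3 → ℝ) (x : R3) : R3 := fun i => pd i f x

/-- Divergence of a vector field. -/
def vdiv (u : R3 → R3) (x : R3) : ℝ := ∑ i, pd i (fun y => u y i) x

/-- Jacobian matrix `(Grad u)ᵢⱼ = ∂uᵢ/∂xⱼ` of a vector field. -/
def vGrad (u : R3 → R3) (x : R3) : Matrix (Fin 3) (Fin 3) ℝ :=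
  Matrix.of fun i j => pd j (fun y => u y i) x

/-- Divergence `(Div A)ⱼ = ∑ᵢ ∂Aᵢⱼ/∂xᵢ` of a matrix field. -/
def mDiv (A : R3 → Matrix (Fin 3) (Fin 3) ℝ) (x : R3) : R3 :=
  fun j => ∑ i, pd i (fun y => A y i j) x

/-- Frobenius inner product `A : B = ∑ᵢⱼ Aᵢⱼ Bᵢⱼ`. -/
def frob (A B : Matrix (Fin 3) (Fin 3) ℝ) : ℝ := ∑ i, ∑ j, A i j * B i j

/-- Curl of a vector field. -/
def curl (u : R3 → R3) (x : R3) : R3 :=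
  ![pd 1 (fun y => u y 2) x - pd 2 (fun y => u y 1) x,
    pd 2 (fun y => u y 0) x - pd 0 (fun y => u y 2) x,
    pd 0 (fun y => u y 1) x - pd 1 (fun y => u y 0) x]

/-- Cross product on ℝ³. -/
def cross (u v : R3) : R3 :=
  ![u 1 * v 2 - u 2 * v 1, u 2 * v 0 - u 0 * v 2, u 0 * v 1 - u 1 * v 0]

theorem pd_mul {i : Fin 3} {f g : R3 → ℝ} {x : R3} (hf : DifferentiableAt ℝ f x)
    (hg : DifferentiableAt ℝ g x) :
    pd i (fun y => f y * g y) x = f x * pd i g x + g x * pd i f x := by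
  simp [pd, fderiv_fun_mul hf hg]

theorem pd_sub {i : Fin 3} {f g : R3 → ℝ} {x : R3} (hf : DifferentiableAt ℝ f x)
    (hg : DifferentiableAt ℝ g x) :
    pd i (fun y => f y - g y) x = pd i f x - pd i g x := by
  simp [pd, fderiv_fun_sub hf hg]

theorem pd_const_mul {i : Fin 3} {f : R3 → ℝ} {x : R3} (c : ℝ) (hf : DifferentiableAt ℝ f x) :
    pd i (fun y => c * f y) x = c * pd i f x := by
  simp [pd, fderiv_const_mul hf]

theorem contDiff_pd {i : Fin 3} {f : R3 → ℝ} (hf : ContDiff ℝ (⊤ : ℕ∞) f) :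
    ContDiff ℝ (⊤ : ℕ∞) (pd i f) :=
  (hf.fderiv_right (m := (⊤ : ℕ∞)) le_rfl).clm_apply contDiff_const

theorem hasCompactSupport_pd {i : Fin 3} {f : R3 → ℝ} (hf : HasCompactSupport f) :
    HasCompactSupport (pd i f) :=
  hf.fderiv_apply ℝ _

theorem integrable_pd {i : Fin 3} {f : R3 → ℝ} (hf : ContDiff ℝ (⊤ : ℕ∞) f)
    (hfs : HasCompactSupport f) : Integrable (pd i f) :=
  (contDiff_pd hf).continuous.integrable_of_hasCompactSupport (hasCompactSupport_pd hfs)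

theorem integral_pd_eq_zero {i : Fin 3} {f : R3 → ℝ} (hf : ContDiff ℝ (⊤ : ℕ∞) f)
    (hfs : HasCompactSupport f) : ∫ x, pd i f x = 0 := by
  have h := integral_mul_fderiv_eq_neg_fderiv_mul_of_integrable (μ := (volume : Measure R3))
    (f := fun _ => (1 : ℝ)) (g := f) (v := Pi.single i 1) (by simp)
    (by simpa [pd] using (integrable_pd hf hfs : Integrable fun x => pd i f x))
    (by simpa using hf.continuous.integrable_of_hasCompactSupport hfs)
    (by fun_prop) (fun x _ => hf.differentiable (by simp) x)
  simpa [pd] using h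

/-- The divergence theorem for smooth compactly supported vector fields. -/
theorem integral_vdiv_eq_zero {u : R3 → R3} (hu : ∀ i, ContDiff ℝ (⊤ : ℕ∞) fun x => u x i)
    (hus : ∀ i, HasCompactSupport fun x => u x i) : ∫ x, vdiv u x = 0 := by
  unfold vdiv
  rw [integral_finsetSum _ fun i _ => integrable_pd (hu i) (hus i)]
  exact Finset.sum_eq_zero fun i _ => integral_pd_eq_zero (hu i) (hus i)

theorem integrable_vdiv {u : R3 → R3} (hu : ∀ i, ContDiff ℝ (⊤ : ℕ∞) fun x => u x i)
    (hus : ∀ i, HasCompactSupport fun x => u x i) : Integrable (vdiv u) :=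
  integrable_finsetSum _ fun i _ => integrable_pd (hu i) (hus i)

theorem contDiff_vdiv {u : R3 → R3} (hu : ∀ i, ContDiff ℝ (⊤ : ℕ∞) fun x => u x i) :
    ContDiff ℝ (⊤ : ℕ∞) (vdiv u) :=
  ContDiff.sum fun i _ => contDiff_pd (hu i)

theorem contDiff_curl {u : R3 → R3} (hu : ∀ i, ContDiff ℝ (⊤ : ℕ∞) fun x => u x i) (i : Fin 3) :
    ContDiff ℝ (⊤ : ℕ∞) fun x => curl u x i := by
  fin_cases i <;> exact (contDiff_pd (hu _)).sub (contDiff_pd (hu _))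

theorem hasCompactSupport_vdiv {u : R3 → R3} (hus : HasCompactSupport u) :
    HasCompactSupport (vdiv u) := by
  have h (i : Fin 3) : HasCompactSupport (pd i fun y => u y i) :=
    hasCompactSupport_pd (hus.comp_left (g := fun w : R3 => w i) rfl)
  have hv : vdiv u = pd 0 (fun y => u y 0) + pd 1 (fun y => u y 1) + pd 2 fun y => u y 2 := by
    funext x
    simp [vdiv, Fin.sum_univ_three]
  rw [hv]
  exact ((h 0).add (h 1)).add (h 2)

theorem hasCompactSupport_curl {u : R3 → R3} (hus : HasCompactSupport u) (i : Fin 3) :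
    HasCompactSupport fun x => curl u x i := by
  have h (j i : Fin 3) : HasCompactSupport (pd j fun y => u y i) :=
    hasCompactSupport_pd (hus.comp_left (g := fun w : R3 => w i) rfl)
  fin_cases i <;> exact (h _ _).sub (h _ _)

theorem vdiv_smul {f : R3 → ℝ} {u : R3 → R3} {x : R3} (hf : DifferentiableAt ℝ f x)
    (hu : ∀ i, DifferentiableAt ℝ (fun y => u y i) x) :
    vdiv (fun y => f y • u y) x = f x * vdiv u x + u x ⬝ᵥ grad f x := by
  simp only [vdiv, Pi.smul_apply, smul_eq_mul, pd_mul hf (hu _), Fin.sum_univ_three, dotProduct,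
    grad]
  ring

theorem vdiv_cross {u w : R3 → R3} {x : R3} (hu : ∀ i, DifferentiableAt ℝ (fun y => u y i) x)
    (hw : ∀ i, DifferentiableAt ℝ (fun y => w y i) x) :
    vdiv (fun y => cross (u y) (w y)) x = w x ⬝ᵥ curl u x - u x ⬝ᵥ curl w x := by
  have h (k i j : Fin 3) : pd k (fun y => u y i * w y j - u y j * w y i) x =
      u x i * pd k (fun y => w y j) x + w x j * pd k (fun y => u y i) x
      - (u x j * pd k (fun y => w y i) x + w x i * pd k (fun y => u y j) x) := by
    rw [pd_sub ((hu i).fun_mul (hw j)) ((hu j).fun_mul (hw i)), pd_mul (hu i) (hw j),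
      pd_mul (hu j) (hw i)]
  simp [vdiv, cross, curl, Fin.sum_univ_three, dotProduct, h]
  ring

theorem dotProduct_cross_self (u w : R3) : w ⬝ᵥ cross u w = 0 := by
  simp [cross, dotProduct, Fin.sum_univ_three]
  ring

theorem curl_const_smul {u : R3 → R3} {x : R3} (c : ℝ)
    (hu : ∀ i, DifferentiableAt ℝ (fun y => u y i) x) :
    curl (fun y => c • u y) x = c • curl u x := by
  have h (k i : Fin 3) : pd k (fun y => c * u y i) x = c * pd k (fun y => u y i) x :=
    pd_const_mul c (hu i)
  funext i
  fin_cases i <;> simp [curl, h] <;> ring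

theorem grad_const_mul {f : R3 → ℝ} {x : R3} (c : ℝ) (hf : DifferentiableAt ℝ f x) :
    grad (fun y => c * f y) x = c • grad f x :=
  funext fun _ => pd_const_mul c hf

theorem contDiff_cross {u w : R3 → R3} (hu : ∀ i, ContDiff ℝ (⊤ : ℕ∞) fun x => u x i)
    (hw : ∀ i, ContDiff ℝ (⊤ : ℕ∞) fun x => w x i) (i : Fin 3) :
    ContDiff ℝ (⊤ : ℕ∞) fun x => cross (u x) (w x) i := by
  fin_cases i <;> exact ((hu _).mul (hw _)).sub ((hu _).mul (hw _))

theorem hasCompactSupport_cross {u w : R3 → R3} (hw : ∀ i, HasCompactSupport fun x => w x i)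
    (i : Fin 3) : HasCompactSupport fun x => cross (u x) (w x) i := by
  fin_cases i <;> exact ((hw _).mul_left).sub ((hw _).mul_left)

/-- Energy-dissipation balance of Proposition 2 of the paper (vanishing boundary terms):
for the isentropic Newtonian fluid with `v = e_v/ρ` and `μhat = (4/3)μ + κ`,
`⟨e, (J − G*SG) e⟩ = −∫ (μ‖curl v‖² + μhat (div v)²) ≤ 0`. -/
theorem stmt5 (ρ e_ρ : R3 → ℝ) (e_v : R3 → R3)
    (hρ : ContDiff ℝ (⊤ : ℕ∞) ρ) (heρ : ContDiff ℝ (⊤ : ℕ∞) e_ρ)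
    (hρpos : ∀ x, 0 < ρ x)
    (hev : ContDiff ℝ (⊤ : ℕ∞) e_v) (hevsupp : HasCompactSupport e_v)
    (v : R3 → R3) (hv : ∀ x, v x = (ρ x)⁻¹ • e_v x)
    (μ κ : ℝ) (hμ : 0 ≤ μ) (hκ : 0 ≤ κ)
    (μhat : ℝ) (hμhat : μhat = (4/3) * μ + κ) :
    (∫ x,
        (e_ρ x * (- vdiv e_v x)
        + e_v x ⬝ᵥ (fun i =>
            - grad e_ρ x i
            - (1 / ρ x) * cross (curl v x) (e_v x) i
            - (1 / ρ x) * curl (fun y => μ • curl v y) x i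
            + (1 / ρ x) * grad (fun y => μhat * vdiv v y) x i))
      = - ∫ x, (μ * (curl v x ⬝ᵥ curl v x) + μhat * (vdiv v x) ^ 2))
    ∧ (- ∫ x, (μ * (curl v x ⬝ᵥ curl v x) + μhat * (vdiv v x) ^ 2)) ≤ 0 := by
  have hμhat0 : 0 ≤ μhat := by rw [hμhat]; positivity
  refine ⟨?_, neg_nonpos.mpr (integral_nonneg fun x => ?_)⟩
  swap
  · have h : 0 ≤ curl v x ⬝ᵥ curl v x := Finset.sum_nonneg fun i _ => mul_self_nonneg _
    have := mul_nonneg hμ h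
    positivity
  have hevi (i) : ContDiff ℝ (⊤ : ℕ∞) fun x => e_v x i := contDiff_pi.mp hev i
  have hevs (i) : HasCompactSupport fun x => e_v x i :=
    hevsupp.comp_left (g := fun w : R3 => w i) rfl
  have hvx (x i) : v x i = (ρ x)⁻¹ * e_v x i := by rw [hv]; rfl
  have hvi (i) : ContDiff ℝ (⊤ : ℕ∞) fun x => v x i := by
    simp only [hvx]
    exact (hρ.inv fun x => (hρpos x).ne').mul (hevi i)
  have hvs : HasCompactSupport v := by
    rw [funext hv]
    exact hevsupp.smul_left (f := fun x => (ρ x)⁻¹)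
  have hvsi (i) : HasCompactSupport fun x => v x i :=
    hvs.comp_left (g := fun w : R3 => w i) rfl
  have hd := contDiff_vdiv hvi
  have hc := contDiff_curl hvi
  have diff {f : R3 → ℝ} (hf : ContDiff ℝ (⊤ : ℕ∞) f) (x : R3) : DifferentiableAt ℝ f x :=
    hf.differentiable (by simp) x
  have hA1 (i) : ContDiff ℝ (⊤ : ℕ∞) fun x => (e_ρ x • e_v x) i := heρ.mul (hevi i)
  have hA2 (i) : HasCompactSupport fun x => (e_ρ x • e_v x) i := (hevs i).mul_left
  have hB1 (i) : ContDiff ℝ (⊤ : ℕ∞) fun x => (vdiv v x • v x) i := hd.mul (hvi i)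
  have hB2 (i) : HasCompactSupport fun x => (vdiv v x • v x) i := (hvsi i).mul_left
  have hC1 := contDiff_cross hc hvi
  have hC2 := hasCompactSupport_cross (u := curl v) hvsi
  have hD : Integrable fun x => μ * (curl v x ⬝ᵥ curl v x) + μhat * (vdiv v x) ^ 2 := by
    have h1 : Integrable fun x => curl v x ⬝ᵥ curl v x :=
      integrable_finsetSum _ fun i _ => ((hc i).mul (hc i)).continuous.integrable_of_hasCompactSupport
        (hasCompactSupport_curl hvs i).mul_left
    have h2 : Integrable fun x => vdiv v x ^ 2 := by
      simpa only [sq] using (hd.mul hd).continuous.integrable_of_hasCompactSupport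
        (hasCompactSupport_vdiv hvs).mul_left
    exact (h1.const_mul μ).add (h2.const_mul μhat)
  have hA := integrable_vdiv hA1 hA2
  have hB := integrable_vdiv hB1 hB2
  have hC := integrable_vdiv hC1 hC2
  have key : ∀ x, e_ρ x * (- vdiv e_v x)
        + e_v x ⬝ᵥ (fun i =>
            - grad e_ρ x i
            - (1 / ρ x) * cross (curl v x) (e_v x) i
            - (1 / ρ x) * curl (fun y => μ • curl v y) x i
            + (1 / ρ x) * grad (fun y => μhat * vdiv v y) x i)
      = μhat * vdiv (fun y => vdiv v y • v y) x - μ * vdiv (fun y => cross (curl v y) (v y)) x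
        - vdiv (fun y => e_ρ y • e_v y) x
        - (μ * (curl v x ⬝ᵥ curl v x) + μhat * (vdiv v x) ^ 2) := by
    intro x
    rw [vdiv_smul (diff hd x) fun i => diff (hvi i) x,
      vdiv_smul (diff heρ x) fun i => diff (hevi i) x,
      vdiv_cross (fun i => diff (hc i) x) fun i => diff (hvi i) x,
      curl_const_smul _ fun i => diff (hc i) x, grad_const_mul _ (diff hd x)]
    have h0 := dotProduct_cross_self (curl v x) (e_v x)
    simp only [dotProduct, Fin.sum_univ_three, Pi.smul_apply, smul_eq_mul, one_div, hvx] at h0 ⊢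
    linear_combination (-(ρ x)⁻¹) * h0
  simp_rw [key]
  have hBC : Integrable fun x => μhat * vdiv (fun y => vdiv v y • v y) x
      - μ * vdiv (fun y => cross (curl v y) (v y)) x := (hB.const_mul _).sub (hC.const_mul _)
  have hBCA : Integrable fun x => μhat * vdiv (fun y => vdiv v y • v y) x
      - μ * vdiv (fun y => cross (curl v y) (v y)) x - vdiv (fun y => e_ρ y • e_v y) x :=
    hBC.sub hA
  rw [integral_sub hBCA hD, integral_sub hBC hA,
    integral_sub (hB.const_mul _) (hC.const_mul _), integral_const_mul, integral_const_mul,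
    integral_vdiv_eq_zero hA1 hA2, integral_vdiv_eq_zero hB1 hB2, integral_vdiv_eq_zero hC1 hC2]
  ring
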